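/- Let m, n ≥ 0 be integers. Let Ω := { (z, t, u, p, q) ∈ ℂ × ℂ^m × ℂ^n × ℂ × ℂ : z ≠ 0, t_r ≠ 0 for all r, u_s ≠ 0 for all s, 0 < |p| < 1, 0 < |q| < 1 }, an open subset of ℂ^{m+n+3}, and let F : ℂ × ℂ^m × ℂ^n × ℂ × ℂ → ℂ be holomorphic on Ω. Let Ω' := { (t, u, p, q) ∈ ℂ^m × ℂ^n × ℂ × ℂ : t_r ≠ 0 for all r, u_s ≠ 0 for all s, 0 < |p| < 1, 0 < |q| < 1 }. For (t,u,p,q) ∈ Ω' with |t_r| < 1 and |u_s| < 1 for all r, s, define G(t,u,p,q) := ∏_{r=0}^{m−1} ∏_{s=0}^{n−1} (t_r u_s;p,q)_∞ · (1/2π) ∫_0^{2π} F(e^{iθ}, t, u, p, q) / ( ∏_{r=0}^{m−1} (t_r e^{iθ};p,q)_∞ · ∏_{s=0}^{n−1} (u_s e^{−iθ};p,q)_∞ ) dθ. Then there exists a function G', holomorphic on all of Ω', such that G'(t,u,p,q) = G(t,u,p,q) whenever |t_r| < 1 and |u_s| < 1 for all r, s; moreover G' is unique (Ω' is connected). -/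

import Mathlib

open scoped BigOperators Real
open MeasureTheory

/-- The double infinite product `(x;p,q)_∞`. -/
noncomputable def poch2 (x p q : ℂ) : ℂ :=
  ∏' jk : ℕ × ℕ, (1 - p ^ jk.1 * q ^ jk.2 * x)

/-- The parameter domain `Ω'`. -/
def Omega' (m n : ℕ) : Set ((Fin m → ℂ) × (Fin n → ℂ) × ℂ × ℂ) :=
  {w | (∀ r, w.1 r ≠ 0) ∧ (∀ s, w.2.1 s ≠ 0) ∧
    0 < ‖w.2.2.1‖ ∧ ‖w.2.2.1‖ < 1 ∧
    0 < ‖w.2.2.2‖ ∧ ‖w.2.2.2‖ < 1}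

open Set Filter Topology Metric

section Holomorphic

variable {E : Type*} [NormedAddCommGroup E] [NormedSpace ℂ E]

theorem differentiableOn_finset_prod {ι : Type*} {f : ι → E → ℂ} {U : Set E} (s : Finset ι)
    (hf : ∀ i ∈ s, DifferentiableOn ℂ (f i) U) :
    DifferentiableOn ℂ (fun x => ∏ i ∈ s, f i x) U := by
  classical
  induction s using Finset.induction_on with
  | empty => simp
  | insert i s hi ih =>
    simp only [Finset.prod_insert hi]
    exact (hf i (Finset.mem_insert_self i s)).mul
      (ih fun j hj => hf j (Finset.mem_insert_of_mem hj))

theorem norm_fderiv_le_of_forall_mem_ball {f : E → ℂ} {c : E} {r M : ℝ} (hr : 0 < r)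
    (hd : DifferentiableOn ℂ f (ball c r)) (hM : ∀ x ∈ ball c r, ‖f x‖ ≤ M) :
    ‖fderiv ℂ f c‖ ≤ 2 * M / r := by
  refine Complex.norm_fderiv_le_div_of_mapsTo_ball hd (fun x hx => ?_) hr
  rw [mem_closedBall, dist_eq_norm, two_mul]
  exact (norm_sub_le _ _).trans (add_le_add (hM x hx) (hM c (mem_ball_self hr)))

theorem differentiableOn_tsum_of_norm_le {ι : Type*} {f : ι → E → ℂ} {U : Set E} {b : ι → ℝ}
    (hU : IsOpen U) (hb : Summable b) (hf : ∀ i, DifferentiableOn ℂ (f i) U)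
    (hfb : ∀ i, ∀ x ∈ U, ‖f i x‖ ≤ b i) :
    DifferentiableOn ℂ (fun x => ∑' i, f i x) U := by
  intro x hx
  obtain ⟨r, hr, hrU⟩ := Metric.isOpen_iff.1 hU x hx
  have hsub : ∀ y ∈ ball x (r / 2), ball y (r / 2) ⊆ U := fun y hy =>
    (ball_subset_ball' (by linarith [mem_ball.1 hy])).trans hrU
  have hyU : ∀ y ∈ ball x (r / 2), y ∈ U := fun y hy => hsub y hy (mem_ball_self (half_pos hr))
  refine (hasFDerivAt_tsum_of_isPreconnected (𝕜 := ℂ) (u := fun i => 2 * b i / (r / 2))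
    (f' := fun i y => fderiv ℂ (f i) y)
    ((hb.mul_left 2).div_const _) isOpen_ball (convex_ball x (r / 2)).isPreconnected
    (fun i y hy => ?_) (fun i y hy => ?_) (mem_ball_self (half_pos hr))
    (Summable.of_norm_bounded hb fun i => hfb i x hx)
    (mem_ball_self (half_pos hr))).differentiableAt.differentiableWithinAt
  · exact ((hf i).differentiableAt (hU.mem_nhds (hyU y hy))).hasFDerivAt
  · exact norm_fderiv_le_of_forall_mem_ball (half_pos hr) ((hf i).mono (hsub y hy))
      fun z hz => hfb i z (hsub y hy hz)

theorem differentiableOn_intervalIntegral [FiniteDimensional ℂ E] {g : ℝ → E → ℂ} {U : Set E}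
    (a b : ℝ) (hU : IsOpen U)
    (hc : ContinuousOn (fun x : ℝ × E => g x.1 x.2) (univ ×ˢ U))
    (hd : ∀ θ, DifferentiableOn ℂ (g θ) U) :
    DifferentiableOn ℂ (fun w => ∫ θ in a..b, g θ w) U := by
  have : ProperSpace E := FiniteDimensional.proper ℂ E
  intro w hw
  obtain ⟨r, hr, hrU⟩ := Metric.nhds_basis_closedBall.mem_iff.1 (hU.mem_nhds hw)
  have hbU : ball w r ⊆ U := ball_subset_closedBall.trans hrU
  have hcθ : ∀ y ∈ U, Continuous fun θ => g θ y := fun y hy => by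
    refine continuousOn_univ.1 (hc.comp (f := fun θ : ℝ => (θ, y)) (by fun_prop) ?_)
    intro θ _
    exact ⟨trivial, hy⟩
  obtain ⟨M, hM⟩ := (isCompact_uIcc (a := a) (b := b)).prod (isCompact_closedBall w r)
    |>.exists_bound_of_continuousOn (hc.mono (prod_mono (subset_univ _) hrU))
  have hcont : Continuous fun θ => fderiv ℂ (g θ) w := by
    refine continuous_iff_continuousAt.2 fun θ₀ => Metric.tendsto_nhds.2 fun ε hε => ?_
    have key : ∀ᶠ θ in 𝓝 θ₀, ∀ y ∈ closedBall w r, ‖g θ y - g θ₀ y‖ < ε * r / 4 := by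
      refine (isCompact_closedBall w r).eventually_forall_of_forall_eventually fun y hy => ?_
      have hat : ContinuousAt (fun x : ℝ × E => g x.1 x.2) (θ₀, y) :=
        hc.continuousAt ((isOpen_univ.prod hU).mem_nhds ⟨trivial, hrU hy⟩)
      have hat2 : ContinuousAt (fun x : ℝ × E => g θ₀ x.2) (θ₀, y) :=
        ContinuousAt.comp (f := fun x : ℝ × E => (θ₀, x.2)) (x := (θ₀, y)) hat (by fun_prop)
      have := (hat.sub hat2).norm
      refine this.eventually_lt_const (by simp; positivity)
    filter_upwards [key] with θ hθ
    have h1 : ∀ θ, DifferentiableAt ℂ (g θ) w := fun θ => (hd θ).differentiableAt (hU.mem_nhds hw)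
    rw [dist_eq_norm, ← fderiv_sub (h1 θ) (h1 θ₀)]
    refine (norm_fderiv_le_of_forall_mem_ball hr (((hd θ).sub (hd θ₀)).mono hbU)
      fun y hy => (hθ y (ball_subset_closedBall hy)).le).trans_lt ?_
    field_simp
    linarith
  refine (intervalIntegral.hasFDerivAt_integral_of_dominated_loc_of_lip (𝕜 := ℂ)
    (bound := fun _ => 2 * (2 * M / (r / 2)))
    (F' := fun θ => fderiv ℂ (g θ) w) (s := ball w (r / 2)) (ball_mem_nhds _ (half_pos hr)) ?_
    ((hcθ w hw).intervalIntegrable _ _) hcont.aestronglyMeasurable ?_ (by simp)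
    (ae_of_all _ fun θ _ => ?_)).2.differentiableAt.differentiableWithinAt
  · filter_upwards [hU.mem_nhds hw] with y hy using (hcθ y hy).aestronglyMeasurable
  · refine ae_of_all _ fun θ hθ => ?_
    have hM' : ∀ y ∈ ball w r, ‖g θ y‖ ≤ M := fun y hy =>
      hM (θ, y) ⟨uIoc_subset_uIcc hθ, ball_subset_closedBall hy⟩
    have hM0 : 0 ≤ M := (norm_nonneg _).trans (hM' w (mem_ball_self hr))
    have hsub : ∀ y ∈ ball w (r / 2), ball y (r / 2) ⊆ ball w r := fun y hy =>
      ball_subset_ball' (by linarith [mem_ball.1 hy])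
    refine Convex.lipschitzOnWith_of_nnnorm_fderiv_le (𝕜 := ℂ) (fun y hy => ?_) (fun y hy => ?_)
      (convex_ball w (r / 2))
    · exact (hd θ).differentiableAt
        (hU.mem_nhds (hbU (hsub y hy (mem_ball_self (half_pos hr)))))
    · have hle := norm_fderiv_le_of_forall_mem_ball (half_pos hr)
        ((hd θ).mono ((hsub y hy).trans hbU)) fun z hz => hM' z (hsub y hy hz)
      rw [← NNReal.coe_le_coe, coe_nnnorm, Real.coe_nnabs, abs_of_nonneg (by positivity)]
      have : 0 ≤ 2 * M / (r / 2) := by positivity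
      linarith
  · exact ((hd θ).differentiableAt (hU.mem_nhds hw)).hasFDerivAt

end Holomorphic

theorem prod_one_sub_mem_span {K ι : Type*} [CommRing K] [AddCommMonoid ι] [LinearOrder ι]
    [IsOrderedCancelAddMonoid ι] (f : ι → K) (hf : ∀ a b, f (a + b) = f a * f b) (t u z : K)
    (S S' : Finset ι) (T : Finset ι) (hT : ∀ a ∈ S, ∀ b ∈ S', a + b ∈ T) :
    ∏ c ∈ T, (1 - f c * (t * u)) ∈
      Ideal.span {∏ a ∈ S, (1 - f a * (t * z)), ∏ b ∈ S', (z - f b * u)} := by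
  classical
  induction S using Finset.induction_on_max generalizing S' T with
  | empty => exact Ideal.mem_span_pair.2 ⟨∏ c ∈ T, (1 - f c * (t * u)), 0, by simp⟩
  | insert a S ha ihS =>
    induction S' using Finset.induction_on_max generalizing T with
    | empty => exact Ideal.mem_span_pair.2 ⟨0, ∏ c ∈ T, (1 - f c * (t * u)), by simp⟩
    | insert b S' hb ihS' =>
      have hab : a + b ∈ T := hT a (by simp) b (by simp)
      have haS : a ∉ S := fun h => lt_irrefl _ (ha a h)
      have hbS : b ∉ S' := fun h => lt_irrefl _ (hb b h)
      have h1 : ∏ c ∈ T.erase (a + b), (1 - f c * (t * u)) ∈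
          Ideal.span {∏ a ∈ S, (1 - f a * (t * z)), ∏ b ∈ insert b S', (z - f b * u)} := by
        refine ihS _ _ fun x hx y hy => Finset.mem_erase.2 ⟨ne_of_lt ?_, hT x (by simp [hx]) y hy⟩
        refine add_lt_add_of_lt_of_le (ha x hx) ?_
        rcases Finset.mem_insert.1 hy with rfl | hy
        exacts [le_rfl, (hb y hy).le]
      have h2 : ∏ c ∈ T.erase (a + b), (1 - f c * (t * u)) ∈
          Ideal.span {∏ a ∈ insert a S, (1 - f a * (t * z)), ∏ b ∈ S', (z - f b * u)} := by
        refine ihS' _ fun x hx y hy => Finset.mem_erase.2 ⟨ne_of_lt ?_, hT x hx y (by simp [hy])⟩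
        refine add_lt_add_of_le_of_lt ?_ (hb y hy)
        rcases Finset.mem_insert.1 hx with rfl | hx
        exacts [le_rfl, (ha x hx).le]
      obtain ⟨c₁, d₁, e₁⟩ := Ideal.mem_span_pair.1 h1
      obtain ⟨c₂, d₂, e₂⟩ := Ideal.mem_span_pair.1 h2
      rw [Finset.prod_insert hbS] at e₁
      rw [Finset.prod_insert haS] at e₂
      rw [← Finset.mul_prod_erase _ _ hab, Finset.prod_insert haS, Finset.prod_insert hbS, hf]
      refine Ideal.mem_span_pair.2
        ⟨c₁ + f a * t * (z - f b * u) * c₂, (1 - f a * (t * z)) * d₁ + f a * t * d₂, ?_⟩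
      linear_combination (1 - f a * (t * z)) * e₁ + f a * t * (z - f b * u) * e₂

theorem prod_mem_span_pair_prod {K ι κ : Type*} [CommRing K] (s : Finset ι) (s' : Finset κ)
    (A : ι → K) (B : κ → K) (R : ι → κ → K)
    (h : ∀ i ∈ s, ∀ j ∈ s', R i j ∈ Ideal.span {A i, B j}) :
    ∏ i ∈ s, ∏ j ∈ s', R i j ∈ Ideal.span {∏ i ∈ s, A i, ∏ j ∈ s', B j} := by
  classical
  have mul_mem : ∀ a b b' x y : K, x ∈ Ideal.span {a, b} → y ∈ Ideal.span {a, b'} →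
      x * y ∈ Ideal.span {a, b * b'} := by
    intro a b b' x y hx hy
    obtain ⟨c, d, rfl⟩ := Ideal.mem_span_pair.1 hx
    obtain ⟨c', d', rfl⟩ := Ideal.mem_span_pair.1 hy
    exact Ideal.mem_span_pair.2 ⟨c * (c' * a + d' * b') + d * b * c', d * d', by ring⟩
  have row : ∀ i ∈ s, ∏ j ∈ s', R i j ∈ Ideal.span {A i, ∏ j ∈ s', B j} := by
    intro i hi
    have := h i hi
    clear h
    induction s' using Finset.induction_on with
    | empty => exact Ideal.mem_span_pair.2 ⟨0, 1, by simp⟩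
    | insert j s' hj ih =>
      rw [Finset.prod_insert hj, Finset.prod_insert hj]
      exact mul_mem _ _ _ _ _ (this j (by simp)) (ih fun k hk => this k (by simp [hk]))
  clear h
  induction s using Finset.induction_on with
  | empty => exact Ideal.mem_span_pair.2 ⟨1, 0, by simp⟩
  | insert i s hi ih =>
    rw [Finset.prod_insert hi, Finset.prod_insert hi, Ideal.span_pair_comm]
    refine mul_mem _ _ _ _ _ ?_ ?_
    · rw [Ideal.span_pair_comm]; exact row i (by simp)
    · rw [Ideal.span_pair_comm]; exact ih fun k hk => row k (by simp [hk])

/-- The index set of the factors split off from the double product. -/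
def indexBox (N : ℕ) : Finset (ℕ × ℕ) := Finset.range N ×ˢ Finset.range N

/-- The double product `(x;p,q)_∞` without the factors indexed by `indexBox N`, as a function
of `(x, p, q)`. -/
noncomputable def pochTail (N : ℕ) (y : ℂ × ℂ × ℂ) : ℂ :=
  Complex.exp (∑' jk : ℕ × ℕ,
    if jk ∈ indexBox N then 0 else Complex.log (1 - y.2.1 ^ jk.1 * y.2.2 ^ jk.2 * y.1))

theorem pochTail_ne_zero (N : ℕ) (y : ℂ × ℂ × ℂ) : pochTail N y ≠ 0 := Complex.exp_ne_zero _

theorem norm_pow_mul_pow_mul_le {ρ X : ℝ} {x p q : ℂ} (hp : ‖p‖ ≤ ρ) (hq : ‖q‖ ≤ ρ)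
    (hx : ‖x‖ ≤ X) (j k : ℕ) : ‖p ^ j * q ^ k * x‖ ≤ ρ ^ j * ρ ^ k * X := by
  have : 0 ≤ ρ := (norm_nonneg _).trans hp
  rw [norm_mul, norm_mul, norm_pow, norm_pow]
  gcongr

theorem norm_le_half_of_notMem_indexBox {N : ℕ} {ρ X : ℝ} (hρ : ρ < 1) (hN : ρ ^ N * X ≤ 1 / 2)
    {x p q : ℂ} (hp : ‖p‖ ≤ ρ) (hq : ‖q‖ ≤ ρ) (hx : ‖x‖ ≤ X) {jk : ℕ × ℕ}
    (hjk : jk ∉ indexBox N) : ‖p ^ jk.1 * q ^ jk.2 * x‖ ≤ 1 / 2 := by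
  have h0 : 0 ≤ ρ := (norm_nonneg _).trans hp
  have hX : 0 ≤ X := (norm_nonneg _).trans hx
  refine (norm_pow_mul_pow_mul_le hp hq hx _ _).trans (le_trans ?_ hN)
  refine mul_le_mul_of_nonneg_right ?_ hX
  simp only [indexBox, Finset.mem_product, Finset.mem_range, not_and_or, not_lt] at hjk
  rcases hjk with h | h
  · exact (mul_le_of_le_one_right (by positivity) (pow_le_one₀ h0 hρ.le)).trans
      (pow_le_pow_of_le_one h0 hρ.le h)
  · exact (mul_le_of_le_one_left (by positivity) (pow_le_one₀ h0 hρ.le)).trans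
      (pow_le_pow_of_le_one h0 hρ.le h)

theorem norm_log_le_of_notMem_indexBox {N : ℕ} {ρ X : ℝ} (hρ : ρ < 1) (hN : ρ ^ N * X ≤ 1 / 2)
    {x p q : ℂ} (hp : ‖p‖ ≤ ρ) (hq : ‖q‖ ≤ ρ) (hx : ‖x‖ ≤ X) (jk : ℕ × ℕ) :
    ‖if jk ∈ indexBox N then 0 else Complex.log (1 - p ^ jk.1 * q ^ jk.2 * x)‖ ≤
      3 / 2 * (ρ ^ jk.1 * ρ ^ jk.2 * X) := by
  have h0 : 0 ≤ ρ := (norm_nonneg _).trans hp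
  have hX : 0 ≤ X := (norm_nonneg _).trans hx
  split_ifs with h
  · rw [norm_zero]; positivity
  · have := Complex.norm_log_one_add_half_le_self (z := -(p ^ jk.1 * q ^ jk.2 * x))
      (by rw [norm_neg]; exact norm_le_half_of_notMem_indexBox hρ hN hp hq hx h)
    rw [norm_neg, ← sub_eq_add_neg] at this
    exact this.trans
      (mul_le_mul_of_nonneg_left (norm_pow_mul_pow_mul_le hp hq hx _ _) (by norm_num))

theorem summable_pow_mul_pow_mul {ρ : ℝ} (h0 : 0 ≤ ρ) (hρ : ρ < 1) (X : ℝ) :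
    Summable fun jk : ℕ × ℕ => 3 / 2 * (ρ ^ jk.1 * ρ ^ jk.2 * X) := by
  have h := summable_geometric_of_lt_one h0 hρ
  exact ((h.mul_of_nonneg h (fun _ => by positivity)
    (fun _ => by positivity)).mul_right X).mul_left _

theorem poch2_eq_prod_mul_pochTail {N : ℕ} {ρ X : ℝ} (hρ : ρ < 1) (hN : ρ ^ N * X ≤ 1 / 2)
    {x p q : ℂ} (hp : ‖p‖ ≤ ρ) (hq : ‖q‖ ≤ ρ) (hx : ‖x‖ ≤ X) :
    poch2 x p q = (∏ jk ∈ indexBox N, (1 - p ^ jk.1 * q ^ jk.2 * x)) * pochTail N (x, p, q) := by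
  have h0 : 0 ≤ ρ := (norm_nonneg _).trans hp
  set f : ℕ × ℕ → ℂ := fun jk => if jk ∈ indexBox N then 1 - p ^ jk.1 * q ^ jk.2 * x else 1
    with hf
  set g : ℕ × ℕ → ℂ := fun jk => if jk ∈ indexBox N then 1 else 1 - p ^ jk.1 * q ^ jk.2 * x
    with hg
  have hlog : ∀ jk, Complex.log (g jk) =
      if jk ∈ indexBox N then 0 else Complex.log (1 - p ^ jk.1 * q ^ jk.2 * x) := fun jk => by
    simp only [hg]; split_ifs <;> simp
  have hsum : Summable fun jk => Complex.log (g jk) := by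
    simp_rw [hlog]
    exact .of_norm_bounded (summable_pow_mul_pow_mul h0 hρ X)
      (norm_log_le_of_notMem_indexBox hρ hN hp hq hx)
  have hne : ∀ jk, g jk ≠ 0 := fun jk => by
    simp only [hg]
    split_ifs with h
    · exact one_ne_zero
    · intro h1
      have h2 := norm_le_half_of_notMem_indexBox hρ hN hp hq hx h
      rw [← sub_eq_zero.1 h1, norm_one] at h2
      norm_num at h2
  have hfone : ∀ jk ∉ indexBox N, f jk = 1 := fun jk h => by simp [hf, h]
  have htail : pochTail N (x, p, q) = ∏' jk, g jk := by
    rw [← Complex.cexp_tsum_eq_tprod hne hsum, pochTail]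
    simp_rw [hlog]
  have hfin : ∏ jk ∈ indexBox N, (1 - p ^ jk.1 * q ^ jk.2 * x) = ∏' jk, f jk := by
    rw [tprod_eq_prod hfone]
    exact Finset.prod_congr rfl fun jk h => by simp [hf, h]
  rw [htail, hfin, ← (multipliable_of_ne_finset_one hfone).tprod_mul
    (Complex.multipliable_of_summable_log hsum), poch2]
  refine tprod_congr fun jk => ?_
  simp only [hf, hg]
  split_ifs <;> simp

theorem differentiableOn_pochTail {N : ℕ} {ρ X : ℝ} (h0 : 0 ≤ ρ) (hρ : ρ < 1)
    (hN : ρ ^ N * X ≤ 1 / 2) :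
    DifferentiableOn ℂ (pochTail N) {y | ‖y.1‖ < X ∧ ‖y.2.1‖ < ρ ∧ ‖y.2.2‖ < ρ} := by
  have hopen : IsOpen {y : ℂ × ℂ × ℂ | ‖y.1‖ < X ∧ ‖y.2.1‖ < ρ ∧ ‖y.2.2‖ < ρ} := by
    refine IsOpen.and ?_ (IsOpen.and ?_ ?_) <;>
      exact isOpen_lt (by fun_prop) continuous_const
  refine (differentiableOn_tsum_of_norm_le hopen (summable_pow_mul_pow_mul h0 hρ X)
    (fun jk => ?_) fun jk y hy => norm_log_le_of_notMem_indexBox hρ hN hy.2.1.le hy.2.2.le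
      hy.1.le jk).cexp
  by_cases h : jk ∈ indexBox N
  · simp [h]
  · simp only [h, if_false]
    refine DifferentiableOn.clog (by fun_prop) fun y hy => ?_
    have := norm_le_half_of_notMem_indexBox hρ hN hy.2.1.le hy.2.2.le hy.1.le h
    rw [sub_eq_add_neg]
    refine Complex.mem_slitPlane_of_norm_lt_one ?_
    rw [norm_neg]
    linarith

theorem one_sub_ne_zero_of_norm_lt_one {x p q : ℂ} (hp : ‖p‖ ≤ 1) (hq : ‖q‖ ≤ 1) (hx : ‖x‖ < 1)
    (j k : ℕ) : 1 - p ^ j * q ^ k * x ≠ 0 := by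
  intro h
  have h1 := norm_pow_mul_pow_mul_le hp hq (le_refl ‖x‖) j k
  rw [← sub_eq_zero.1 h] at h1
  simp only [norm_one, one_pow, one_mul] at h1
  linarith

theorem eqOn_of_eqOn_unit_ball {X Y Z : Type*} [NormedAddCommGroup X] [NormedSpace ℂ X]
    [NormedAddCommGroup Y] [NormedSpace ℂ Y] [NormedAddCommGroup Z] [NormedSpace ℂ Z]
    {U : Set (X × Y × Z)} (hU : IsOpen U)
    (hs : ∀ w ∈ U, ∀ c : ℂ, c ≠ 0 → ‖c‖ ≤ 1 → (c • w.1, c • w.2.1, w.2.2) ∈ U)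
    {f g : X × Y × Z → ℂ} (hf : DifferentiableOn ℂ f U) (hg : DifferentiableOn ℂ g U)
    (h : ∀ w ∈ U, ‖w.1‖ < 1 → ‖w.2.1‖ < 1 → f w = g w) : EqOn f g U := by
  intro w hw
  let φ : ℂ → X × Y × Z := fun s => (Complex.exp (-s) • w.1, Complex.exp (-s) • w.2.1, w.2.2)
  have hφ : Differentiable ℂ φ := by fun_prop
  have hφU : ∀ s ∈ {s : ℂ | 0 ≤ s.re}, s ∈ φ ⁻¹' U := fun s hs' =>
    hs w hw _ (Complex.exp_ne_zero _) (by simpa [Complex.norm_exp] using hs')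
  have hopen : IsOpen (φ ⁻¹' U) := hU.preimage hφ.continuous
  have han : ∀ k : X × Y × Z → ℂ, DifferentiableOn ℂ k U →
      AnalyticOnNhd ℂ (k ∘ φ) {s : ℂ | 0 ≤ s.re} := fun k hk =>
    ((hk.comp hφ.differentiableOn fun _ hs => hs).analyticOnNhd hopen).mono hφU
  set L : ℝ := max ‖w.1‖ ‖w.2.1‖ with hL
  have hL0 : 0 ≤ L := (norm_nonneg _).trans (le_max_left _ _)
  have hsmall : ∀ s : ℂ, L < s.re → ∀ a : ℝ, a ≤ L → ‖Complex.exp (-s)‖ * a < 1 := by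
    intro s hs' a ha
    rw [Complex.norm_exp, Complex.neg_re, Real.exp_neg, inv_mul_lt_iff₀ (Real.exp_pos _), mul_one]
    linarith [Real.add_one_le_exp s.re]
  have hev : f ∘ φ =ᶠ[𝓝 ((L + 1 : ℝ) : ℂ)] g ∘ φ := by
    have : {s : ℂ | L < s.re} ∈ 𝓝 ((L + 1 : ℝ) : ℂ) :=
      (isOpen_lt continuous_const Complex.continuous_re).mem_nhds (by simp)
    filter_upwards [this] with s hs'
    refine h _ (hφU s (hL0.trans (le_of_lt hs'))) ?_ ?_
    · simpa only [φ, norm_smul] using hsmall s hs' _ (le_max_left _ _)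
    · simpa only [φ, norm_smul] using hsmall s hs' _ (le_max_right _ _)
  have hpre : IsPreconnected {s : ℂ | 0 ≤ s.re} :=
    (convex_halfSpace_re_ge 0).isPreconnected
  have := (han f hf).eqOn_of_preconnected_of_eventuallyEq (han g hg) hpre
    (z₀ := ((L + 1 : ℝ) : ℂ)) (by simp; positivity) hev (x := 0) (by simp)
  simpa [φ] using this

theorem intervalIntegral_circleMap_eq_of_annulus {f : ℂ → ℂ} {V : Set ℂ} {r R : ℝ} (hr : 0 < r)
    (hrR : r ≤ R) (hV : IsOpen V) (hf : DifferentiableOn ℂ f V)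
    (h : ∀ z : ℂ, r ≤ ‖z‖ → ‖z‖ ≤ R → z ∈ V) :
    ∫ θ in (0 : ℝ)..2 * π, f (circleMap 0 R θ) = ∫ θ in (0 : ℝ)..2 * π, f (circleMap 0 r θ) := by
  have key :=
    Complex.circleIntegral_sub_center_inv_smul_eq_of_differentiable_on_annulus_off_countable
    (c := 0) (f := f) hr hrR countable_empty
    (hf.continuousOn.mono fun z hz => h z (by simpa using hz.2) (by simpa using hz.1))
    (fun z hz => hf.differentiableAt (hV.mem_nhds (h z
      (by simpa using le_of_lt (by simpa using hz.1.2))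
      (by simpa using le_of_lt (by simpa using hz.1.1)))))
  have aux : ∀ s : ℝ, 0 < s → (∮ z in C(0, s), (z - 0)⁻¹ • f z) =
      Complex.I * ∫ θ in (0 : ℝ)..2 * π, f (circleMap 0 s θ) := by
    intro s hs
    rw [circleIntegral, ← intervalIntegral.integral_const_mul]
    refine intervalIntegral.integral_congr fun θ _ => ?_
    have : circleMap 0 s θ ≠ 0 := circleMap_ne_center hs.ne'
    simp only [deriv_circleMap, sub_zero, smul_eq_mul]
    field_simp
  rw [aux _ (hr.trans_le hrR), aux _ hr] at key
  exact mul_left_cancel₀ Complex.I_ne_zero key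

/-- The ring of entire functions on a complex normed space. -/
def entireSubring (V : Type*) [NormedAddCommGroup V] [NormedSpace ℂ V] : Subring (V → ℂ) where
  carrier := {f | Differentiable ℂ f}
  mul_mem' := Differentiable.mul
  one_mem' := differentiable_const 1
  add_mem' := Differentiable.add
  zero_mem' := differentiable_const 0
  neg_mem' := Differentiable.neg

theorem exists_bezout_indexBox (m n N : ℕ) :
    ∃ a b : ℂ × (Fin m → ℂ) × (Fin n → ℂ) × ℂ × ℂ → ℂ, Differentiable ℂ a ∧ Differentiable ℂ b ∧
      ∀ z t u p q,
        ∏ r, ∏ s, ∏ c ∈ indexBox (2 * N), (1 - p ^ c.1 * q ^ c.2 * (t r * u s)) =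
          a (z, t, u, p, q) * (∏ r, ∏ c ∈ indexBox N, (1 - p ^ c.1 * q ^ c.2 * (t r * z))) +
          b (z, t, u, p, q) * ∏ s, ∏ c ∈ indexBox N, (z - p ^ c.1 * q ^ c.2 * u s) := by
  let K := entireSubring (ℂ × (Fin m → ℂ) × (Fin n → ℂ) × ℂ × ℂ)
  let z : K := ⟨fun x => x.1, show Differentiable ℂ _ by fun_prop⟩
  let t : Fin m → K := fun r => ⟨fun x => x.2.1 r, show Differentiable ℂ _ by fun_prop⟩
  let u : Fin n → K := fun s => ⟨fun x => x.2.2.1 s, show Differentiable ℂ _ by fun_prop⟩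
  let p : K := ⟨fun x => x.2.2.2.1, show Differentiable ℂ _ by fun_prop⟩
  let q : K := ⟨fun x => x.2.2.2.2, show Differentiable ℂ _ by fun_prop⟩
  let e : ℕ × ℕ ↪ ℕ ×ₗ ℕ := toLex.toEmbedding
  have key := prod_mem_span_pair_prod Finset.univ Finset.univ
    (fun r => ∏ c ∈ (indexBox N).map e, (1 - p ^ (ofLex c).1 * q ^ (ofLex c).2 * (t r * z)))
    (fun s => ∏ c ∈ (indexBox N).map e, (z - p ^ (ofLex c).1 * q ^ (ofLex c).2 * u s))
    (fun r s => ∏ c ∈ (indexBox (2 * N)).map e,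
      (1 - p ^ (ofLex c).1 * q ^ (ofLex c).2 * (t r * u s)))
    (fun r _ s _ => prod_one_sub_mem_span (fun c : ℕ ×ₗ ℕ => p ^ (ofLex c).1 * q ^ (ofLex c).2)
      (fun c d => by simp only [ofLex_add, Prod.fst_add, Prod.snd_add]; ring)
      (t r) (u s) z _ _ _ (by
        simp only [Finset.mem_map, indexBox, Finset.mem_product, Finset.mem_range]
        rintro _ ⟨c, hc, rfl⟩ _ ⟨d, hd, rfl⟩
        exact ⟨c + d, ⟨by simp only [Prod.fst_add]; omega, by simp only [Prod.snd_add]; omega⟩,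
          rfl⟩))
  obtain ⟨a, b, hab⟩ := Ideal.mem_span_pair.1 key
  refine ⟨a.1, b.1, a.2, b.2, fun z' t' u' p' q' => ?_⟩
  have h := congrArg (fun k : K => k.1 (z', t', u', p', q')) hab.symm
  simpa [z, t, u, p, q, e, Finset.prod_apply] using h

section Continuation

variable {m n : ℕ}

/-- The part of the parameter domain where the parameters are bounded by `R` and the nomes
by `ρ`. -/
def boundedRegion (m n : ℕ) (R ρ : ℝ) : Set ((Fin m → ℂ) × (Fin n → ℂ) × ℂ × ℂ) :=
  {w | w ∈ Omega' m n ∧ ‖w.1‖ < R ∧ ‖w.2.1‖ < R ∧ ‖w.2.2.1‖ < ρ ∧ ‖w.2.2.2‖ < ρ}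

/-- The points `(z, t, u, p, q)` over `boundedRegion m n R ρ` with `z ≠ 0`, `‖t‖ * ‖z‖ < α` and
`‖u‖ < β * ‖z‖`. -/
def annularRegion (m n : ℕ) (R ρ α β : ℝ) : Set (ℂ × (Fin m → ℂ) × (Fin n → ℂ) × ℂ × ℂ) :=
  {x | x.1 ≠ 0 ∧ x.2 ∈ boundedRegion m n R ρ ∧ ‖x.2.1‖ * ‖x.1‖ < α ∧ ‖x.2.2.1‖ < β * ‖x.1‖}

theorem isOpen_Omega' (m n : ℕ) : IsOpen (Omega' m n) := by
  unfold Omega'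
  simp only [ofPred_and, ofPred_forall]
  refine (isOpen_iInter_of_finite fun r => isOpen_ne_fun (by fun_prop) (by fun_prop)).inter
    ((isOpen_iInter_of_finite fun s => isOpen_ne_fun (by fun_prop) (by fun_prop)).inter ?_)
  refine IsOpen.inter ?_ (IsOpen.inter ?_ (IsOpen.inter ?_ ?_)) <;>
    exact isOpen_lt (by fun_prop) (by fun_prop)

theorem isOpen_boundedRegion (m n : ℕ) (R ρ : ℝ) : IsOpen (boundedRegion m n R ρ) := by
  refine (isOpen_Omega' m n).and (IsOpen.and ?_ (IsOpen.and ?_ (IsOpen.and ?_ ?_))) <;>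
    exact isOpen_lt (by fun_prop) continuous_const

theorem isOpen_annularRegion (m n : ℕ) (R ρ α β : ℝ) : IsOpen (annularRegion m n R ρ α β) := by
  refine IsOpen.and ?_ (IsOpen.and ?_ (IsOpen.and ?_ ?_))
  · exact isOpen_ne_fun (by fun_prop) continuous_const
  · exact (isOpen_boundedRegion m n R ρ).preimage continuous_snd
  · exact isOpen_lt (by fun_prop) continuous_const
  · exact isOpen_lt (by fun_prop) (by fun_prop)

theorem smul_mem_Omega' {w : (Fin m → ℂ) × (Fin n → ℂ) × ℂ × ℂ} (hw : w ∈ Omega' m n) {c : ℂ}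
    (hc : c ≠ 0) : (c • w.1, c • w.2.1, w.2.2) ∈ Omega' m n :=
  ⟨fun r => mul_ne_zero hc (hw.1 r), fun s => mul_ne_zero hc (hw.2.1 s), hw.2.2⟩

theorem smul_mem_boundedRegion {R ρ : ℝ} {w : (Fin m → ℂ) × (Fin n → ℂ) × ℂ × ℂ}
    (hw : w ∈ boundedRegion m n R ρ) {c : ℂ} (hc : c ≠ 0) (hc1 : ‖c‖ ≤ 1) :
    (c • w.1, c • w.2.1, w.2.2) ∈ boundedRegion m n R ρ := by
  refine ⟨smul_mem_Omega' hw.1 hc, lt_of_le_of_lt ?_ hw.2.1, lt_of_le_of_lt ?_ hw.2.2.1, hw.2.2.2⟩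
  all_goals
    rw [norm_smul]
    exact mul_le_of_le_one_left (norm_nonneg _) hc1

variable {R ρ α β : ℝ} {x : ℂ × (Fin m → ℂ) × (Fin n → ℂ) × ℂ × ℂ}

theorem norm_mul_lt_of_mem_annularRegion (hx : x ∈ annularRegion m n R ρ α β) (r : Fin m) :
    ‖x.2.1 r * x.1‖ < α := by
  rw [norm_mul]
  exact (mul_le_mul_of_nonneg_right (norm_le_pi_norm _ r) (norm_nonneg _)).trans_lt hx.2.2.1

theorem norm_mul_inv_lt_of_mem_annularRegion (hx : x ∈ annularRegion m n R ρ α β) (s : Fin n) :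
    ‖x.2.2.1 s * x.1⁻¹‖ < β := by
  rw [norm_mul, norm_inv, mul_inv_lt_iff₀ (norm_pos_iff.2 hx.1)]
  exact (norm_le_pi_norm _ s).trans_lt hx.2.2.2

theorem norm_mul_lt_of_mem_boundedRegion {w : (Fin m → ℂ) × (Fin n → ℂ) × ℂ × ℂ}
    (hw : w ∈ boundedRegion m n R ρ) (r : Fin m) (s : Fin n) : ‖w.1 r * w.2.1 s‖ < R ^ 2 := by
  rw [norm_mul, sq]
  exact mul_lt_mul'' ((norm_le_pi_norm _ r).trans_lt hw.2.1)
    ((norm_le_pi_norm _ s).trans_lt hw.2.2.1) (norm_nonneg _) (norm_nonneg _)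

theorem annularRegion_mono {α' β' : ℝ} (hα : α ≤ α') (hβ : β ≤ β') :
    annularRegion m n R ρ α β ⊆ annularRegion m n R ρ α' β' := fun _ hx =>
  ⟨hx.1, hx.2.1, hx.2.2.1.trans_le hα,
    hx.2.2.2.trans_le (mul_le_mul_of_nonneg_right hβ (norm_nonneg _))⟩

/-- The integrand over the circle, with `w = (t, u, p, q)`. -/
noncomputable def pochIntegrand (F : ℂ × (Fin m → ℂ) × (Fin n → ℂ) × ℂ × ℂ → ℂ)
    (x : ℂ × (Fin m → ℂ) × (Fin n → ℂ) × ℂ × ℂ) : ℂ :=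
  F x / ((∏ r, poch2 (x.2.1 r * x.1) x.2.2.2.1 x.2.2.2.2) *
    ∏ s, poch2 (x.2.2.1 s * x.1⁻¹) x.2.2.2.1 x.2.2.2.2)

/-- The part of the denominator of the integrand without zeros. -/
noncomputable def tailProd (N : ℕ) (x : ℂ × (Fin m → ℂ) × (Fin n → ℂ) × ℂ × ℂ) : ℂ :=
  (∏ r, pochTail N (x.2.1 r * x.1, x.2.2.2.1, x.2.2.2.2)) *
    ∏ s, pochTail N (x.2.2.1 s * x.1⁻¹, x.2.2.2.1, x.2.2.2.2)

/-- The factors of the denominator with zeros at `z = 1 / (p^j q^k t_r)`. -/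
noncomputable def headProd (N : ℕ) (x : ℂ × (Fin m → ℂ) × (Fin n → ℂ) × ℂ × ℂ) : ℂ :=
  ∏ r, ∏ c ∈ indexBox N, (1 - x.2.2.2.1 ^ c.1 * x.2.2.2.2 ^ c.2 * (x.2.1 r * x.1))

/-- The factors of the denominator with zeros at `z = p^j q^k u_s`. -/
noncomputable def headProdInv (N : ℕ) (x : ℂ × (Fin m → ℂ) × (Fin n → ℂ) × ℂ × ℂ) : ℂ :=
  ∏ s, ∏ c ∈ indexBox N, (1 - x.2.2.2.1 ^ c.1 * x.2.2.2.2 ^ c.2 * (x.2.2.1 s * x.1⁻¹))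

theorem tailProd_ne_zero (N : ℕ) (x : ℂ × (Fin m → ℂ) × (Fin n → ℂ) × ℂ × ℂ) :
    tailProd N x ≠ 0 :=
  mul_ne_zero (Finset.prod_ne_zero_iff.2 fun _ _ => pochTail_ne_zero _ _)
    (Finset.prod_ne_zero_iff.2 fun _ _ => pochTail_ne_zero _ _)

theorem differentiableOn_tailProd {N : ℕ} {X : ℝ} (h0 : 0 ≤ ρ) (hρ : ρ < 1)
    (hN : ρ ^ N * X ≤ 1 / 2) :
    DifferentiableOn ℂ (tailProd N) (annularRegion m n R ρ X X) := by
  have hT := differentiableOn_pochTail h0 hρ hN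
  refine DifferentiableOn.mul (differentiableOn_finset_prod _ fun r _ => ?_)
    (differentiableOn_finset_prod _ fun s _ => ?_)
  · exact hT.comp (f := fun x : ℂ × (Fin m → ℂ) × (Fin n → ℂ) × ℂ × ℂ =>
      (x.2.1 r * x.1, x.2.2.2.1, x.2.2.2.2)) (by fun_prop) fun x hx =>
      ⟨norm_mul_lt_of_mem_annularRegion hx r, hx.2.1.2.2.2⟩
  · refine hT.comp (f := fun x : ℂ × (Fin m → ℂ) × (Fin n → ℂ) × ℂ × ℂ =>
      (x.2.2.1 s * x.1⁻¹, x.2.2.2.1, x.2.2.2.2)) ?_ fun x hx =>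
      ⟨norm_mul_inv_lt_of_mem_annularRegion hx s, hx.2.1.2.2.2⟩
    have : DifferentiableOn ℂ (fun x : ℂ × (Fin m → ℂ) × (Fin n → ℂ) × ℂ × ℂ => x.1⁻¹)
      (annularRegion m n R ρ X X) := differentiableOn_fst.inv fun x hx => hx.1
    fun_prop

theorem differentiable_headProd (N : ℕ) : Differentiable ℂ (headProd (m := m) (n := n) N) :=
  differentiableOn_univ.1 <| differentiableOn_finset_prod _ fun r _ =>
    differentiableOn_finset_prod _ fun c _ => by fun_prop

theorem differentiableOn_headProdInv (N : ℕ) :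
    DifferentiableOn ℂ (headProdInv N) (annularRegion m n R ρ α β) := by
  have : DifferentiableOn ℂ (fun x : ℂ × (Fin m → ℂ) × (Fin n → ℂ) × ℂ × ℂ => x.1⁻¹)
    (annularRegion m n R ρ α β) := differentiableOn_fst.inv fun x hx => hx.1
  exact differentiableOn_finset_prod _ fun s _ => differentiableOn_finset_prod _ fun c _ => by
    fun_prop

theorem headProd_ne_zero (N : ℕ) (hα : α ≤ 1) (hx : x ∈ annularRegion m n R ρ α β) :
    headProd N x ≠ 0 :=
  Finset.prod_ne_zero_iff.2 fun r _ => Finset.prod_ne_zero_iff.2 fun _ _ =>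
    one_sub_ne_zero_of_norm_lt_one hx.2.1.1.2.2.2.1.le hx.2.1.1.2.2.2.2.2.le
      ((norm_mul_lt_of_mem_annularRegion hx r).trans_le hα) _ _

theorem headProdInv_ne_zero (N : ℕ) (hβ : β ≤ 1) (hx : x ∈ annularRegion m n R ρ α β) :
    headProdInv N x ≠ 0 :=
  Finset.prod_ne_zero_iff.2 fun s _ => Finset.prod_ne_zero_iff.2 fun _ _ =>
    one_sub_ne_zero_of_norm_lt_one hx.2.1.1.2.2.2.1.le hx.2.1.1.2.2.2.2.2.le
      ((norm_mul_inv_lt_of_mem_annularRegion hx s).trans_le hβ) _ _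

theorem denominator_eq {N : ℕ} {X : ℝ} (hρ : ρ < 1) (hN : ρ ^ N * X ≤ 1 / 2)
    (hx : x ∈ annularRegion m n R ρ X X) :
    (∏ r, poch2 (x.2.1 r * x.1) x.2.2.2.1 x.2.2.2.2) *
      ∏ s, poch2 (x.2.2.1 s * x.1⁻¹) x.2.2.2.1 x.2.2.2.2 =
    headProd N x * headProdInv N x * tailProd N x := by
  have h1 : ∀ r, _ := fun r => poch2_eq_prod_mul_pochTail hρ hN hx.2.1.2.2.2.1.le
    hx.2.1.2.2.2.2.le (norm_mul_lt_of_mem_annularRegion hx r).le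
  have h2 : ∀ s, _ := fun s => poch2_eq_prod_mul_pochTail hρ hN hx.2.1.2.2.2.1.le
    hx.2.1.2.2.2.2.le (norm_mul_inv_lt_of_mem_annularRegion hx s).le
  simp only [h1, h2, Finset.prod_mul_distrib, headProd, headProdInv, tailProd]
  ring

theorem differentiableOn_circleMap_integral {h : ℂ × (Fin m → ℂ) × (Fin n → ℂ) × ℂ × ℂ → ℂ}
    {O : Set (ℂ × (Fin m → ℂ) × (Fin n → ℂ) × ℂ × ℂ)}
    {U : Set ((Fin m → ℂ) × (Fin n → ℂ) × ℂ × ℂ)} (hh : DifferentiableOn ℂ h O)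
    (hU : IsOpen U) {r : ℝ} (hO : ∀ z : ℂ, ‖z‖ = |r| → ∀ w ∈ U, (z, w) ∈ O) :
    DifferentiableOn ℂ (fun w => ∫ θ in (0 : ℝ)..2 * π, h (circleMap 0 r θ, w)) U := by
  have hmem : ∀ θ, ∀ w ∈ U, (circleMap 0 r θ, w) ∈ O := fun θ w hw => hO _ (by simp) w hw
  refine differentiableOn_intervalIntegral (g := fun θ w => h (circleMap 0 r θ, w)) _ _ hU ?_
    fun θ => ?_
  · exact hh.continuousOn.comp (by fun_prop) fun x hx => hmem x.1 x.2 hx.2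
  · exact hh.comp (by fun_prop) fun w hw => hmem θ w hw

theorem exists_differentiableOn_boundedRegion
    {F : ℂ × (Fin m → ℂ) × (Fin n → ℂ) × ℂ × ℂ → ℂ}
    (hF : DifferentiableOn ℂ F {x | x.1 ≠ 0 ∧ x.2 ∈ Omega' m n}) (hR : 1 < R) (h0 : 0 < ρ)
    (hρ : ρ < 1) :
    ∃ G : (Fin m → ℂ) × (Fin n → ℂ) × ℂ × ℂ → ℂ,
      DifferentiableOn ℂ G (boundedRegion m n R ρ) ∧
      ∀ w ∈ boundedRegion m n R ρ, ‖w.1‖ < 1 → ‖w.2.1‖ < 1 →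
        G w = (∏ r, ∏ s, poch2 (w.1 r * w.2.1 s) w.2.2.1 w.2.2.2) *
          (((1 / (2 * π) : ℝ) : ℂ) *
            ∫ θ in (0 : ℝ)..2 * π, pochIntegrand F (circleMap 0 1 θ, w)) := by
  have hR0 : 0 < R := one_pos.trans hR
  have hX1 : 1 ≤ R ^ 2 := one_le_pow₀ hR.le
  obtain ⟨N, hN⟩ : ∃ N : ℕ, ρ ^ N * R ^ 2 ≤ 1 / 2 := by
    obtain ⟨N, hN⟩ := exists_pow_lt_of_lt_one (show (0 : ℝ) < 1 / 2 / R ^ 2 by positivity) hρ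
    exact ⟨N, ((lt_div_iff₀ (by positivity)).1 hN).le⟩
  have hN2 : ρ ^ (2 * N) * R ^ 2 ≤ 1 / 2 := le_trans (mul_le_mul_of_nonneg_right
    (pow_le_pow_of_le_one h0.le hρ.le (by omega)) (by positivity)) hN
  obtain ⟨a, b, ha, hb, hab⟩ := exists_bezout_indexBox m n N
  set Q : (Fin m → ℂ) × (Fin n → ℂ) × ℂ × ℂ → ℂ := fun w =>
    ∏ r, ∏ s, pochTail (2 * N) (w.1 r * w.2.1 s, w.2.2.1, w.2.2.2) with hQ
  set hA : ℂ × (Fin m → ℂ) × (Fin n → ℂ) × ℂ × ℂ → ℂ := fun x =>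
    a x * F x * (headProdInv N x * tailProd N x)⁻¹ with hAdef
  set hB : ℂ × (Fin m → ℂ) × (Fin n → ℂ) × ℂ × ℂ → ℂ := fun x =>
    b x * (∏ _s : Fin n, ∏ _c ∈ indexBox N, x.1) * F x * (headProd N x * tailProd N x)⁻¹ with hBdef
  have hsubA : annularRegion m n R ρ (R ^ 2) 1 ⊆ annularRegion m n R ρ (R ^ 2) (R ^ 2) :=
    annularRegion_mono le_rfl hX1
  have hsubB : annularRegion m n R ρ 1 (R ^ 2) ⊆ annularRegion m n R ρ (R ^ 2) (R ^ 2) :=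
    annularRegion_mono hX1 le_rfl
  have hFX : DifferentiableOn ℂ F (annularRegion m n R ρ (R ^ 2) (R ^ 2)) :=
    hF.mono fun x hx => ⟨hx.1, hx.2.1.1⟩
  have hTX : DifferentiableOn ℂ (tailProd N) (annularRegion m n R ρ (R ^ 2) (R ^ 2)) :=
    differentiableOn_tailProd h0.le hρ hN
  have hAd : DifferentiableOn ℂ hA (annularRegion m n R ρ (R ^ 2) 1) :=
    (ha.differentiableOn.mul (hFX.mono hsubA)).mul
      (((differentiableOn_headProdInv N).mul (hTX.mono hsubA)).inv
        fun x hx => mul_ne_zero (headProdInv_ne_zero N le_rfl hx) (tailProd_ne_zero N x))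
  have hBd : DifferentiableOn ℂ hB (annularRegion m n R ρ 1 (R ^ 2)) :=
    ((hb.differentiableOn.mul (differentiableOn_finset_prod _ fun _ _ =>
        differentiableOn_finset_prod _ fun _ _ => differentiableOn_fst)).mul (hFX.mono hsubB)).mul
      (((differentiable_headProd N).differentiableOn.mul (hTX.mono hsubB)).inv
        fun x hx => mul_ne_zero (headProd_ne_zero N le_rfl hx) (tailProd_ne_zero N x))
  have hQd : DifferentiableOn ℂ Q (boundedRegion m n R ρ) := by
    refine differentiableOn_finset_prod _ fun r _ => differentiableOn_finset_prod _ fun s _ => ?_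
    exact (differentiableOn_pochTail h0.le hρ hN2).comp
      (f := fun w : (Fin m → ℂ) × (Fin n → ℂ) × ℂ × ℂ => (w.1 r * w.2.1 s, w.2.2.1, w.2.2.2))
      (by fun_prop) fun w hw => ⟨norm_mul_lt_of_mem_boundedRegion hw r s, hw.2.2.2⟩
  have hmemA : ∀ z : ℂ, 1 ≤ ‖z‖ → ‖z‖ ≤ R → ∀ w ∈ boundedRegion m n R ρ,
      ‖w.2.1‖ < ‖z‖ → (z, w) ∈ annularRegion m n R ρ (R ^ 2) 1 := by
    intro z hz1 hzR w hw hu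
    refine ⟨norm_pos_iff.1 (one_pos.trans_le hz1), hw, ?_, by simpa using hu⟩
    rw [sq]
    exact (mul_le_mul_of_nonneg_left hzR (norm_nonneg _)).trans_lt
      (mul_lt_mul_of_pos_right hw.2.1 hR0)
  have hmemB : ∀ z : ℂ, R⁻¹ ≤ ‖z‖ → ‖z‖ ≤ 1 → ∀ w ∈ boundedRegion m n R ρ,
      ‖w.1‖ * ‖z‖ < 1 → (z, w) ∈ annularRegion m n R ρ 1 (R ^ 2) := by
    intro z hz1 hzR w hw ht
    refine ⟨norm_pos_iff.1 ((inv_pos.2 hR0).trans_le hz1), hw, ht, ?_⟩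
    calc ‖w.2.1‖ < R := hw.2.2.1
      _ = R ^ 2 * R⁻¹ := by field_simp
      _ ≤ R ^ 2 * ‖z‖ := by gcongr
  refine ⟨fun w => Q w * (((1 / (2 * π) : ℝ) : ℂ) *
    ((∫ θ in (0 : ℝ)..2 * π, hA (circleMap 0 R θ, w)) +
      ∫ θ in (0 : ℝ)..2 * π, hB (circleMap 0 R⁻¹ θ, w))), ?_, ?_⟩
  · refine hQd.mul (DifferentiableOn.const_mul (DifferentiableOn.add ?_ ?_) _)
    · refine differentiableOn_circleMap_integral hAd (isOpen_boundedRegion m n R ρ) ?_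
      intro z hz w hw
      rw [abs_of_pos hR0] at hz
      exact hmemA z (hz ▸ hR.le) hz.le w hw (hz ▸ hw.2.2.1)
    · refine differentiableOn_circleMap_integral hBd (isOpen_boundedRegion m n R ρ) ?_
      intro z hz w hw
      rw [abs_of_pos (inv_pos.2 hR0)] at hz
      refine hmemB z hz.ge (hz.trans_le (inv_le_one_of_one_le₀ hR.le)) w hw ?_
      rw [hz, mul_inv_lt_iff₀ hR0, one_mul]
      exact hw.2.1
  · intro w hw ht hu
    have hsliceA : DifferentiableOn ℂ (fun z => hA (z, w))
        ((fun z => (z, w)) ⁻¹' annularRegion m n R ρ (R ^ 2) 1) :=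
      hAd.comp (by fun_prop) fun z hz => hz
    have hsliceB : DifferentiableOn ℂ (fun z => hB (z, w))
        ((fun z => (z, w)) ⁻¹' annularRegion m n R ρ 1 (R ^ 2)) :=
      hBd.comp (by fun_prop) fun z hz => hz
    have hannA : ∀ z : ℂ, 1 ≤ ‖z‖ → ‖z‖ ≤ R → (z, w) ∈ annularRegion m n R ρ (R ^ 2) 1 :=
      fun z hz1 hzR => hmemA z hz1 hzR w hw (hu.trans_le hz1)
    have hannB : ∀ z : ℂ, R⁻¹ ≤ ‖z‖ → ‖z‖ ≤ 1 → (z, w) ∈ annularRegion m n R ρ 1 (R ^ 2) :=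
      fun z hz1 hzR => hmemB z hz1 hzR w hw
        ((mul_le_of_le_one_right (norm_nonneg _) hzR).trans_lt ht)
    have eA : ∫ θ in (0 : ℝ)..2 * π, hA (circleMap 0 R θ, w) =
        ∫ θ in (0 : ℝ)..2 * π, hA (circleMap 0 1 θ, w) :=
      intervalIntegral_circleMap_eq_of_annulus one_pos hR.le
        ((isOpen_annularRegion m n R ρ _ _).preimage (by fun_prop)) hsliceA hannA
    have eB : ∫ θ in (0 : ℝ)..2 * π, hB (circleMap 0 1 θ, w) =
        ∫ θ in (0 : ℝ)..2 * π, hB (circleMap 0 R⁻¹ θ, w) :=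
      intervalIntegral_circleMap_eq_of_annulus (inv_pos.2 hR0) (inv_le_one_of_one_le₀ hR.le)
        ((isOpen_annularRegion m n R ρ _ _).preimage (by fun_prop)) hsliceB hannB
    have hcircle : ∀ θ, ‖circleMap 0 1 θ‖ = 1 := fun θ => by simp
    have mA : ∀ θ, (circleMap 0 1 θ, w) ∈ annularRegion m n R ρ (R ^ 2) 1 := fun θ =>
      hannA _ (hcircle θ).ge ((hcircle θ).trans_le hR.le)
    have mB : ∀ θ, (circleMap 0 1 θ, w) ∈ annularRegion m n R ρ 1 (R ^ 2) := fun θ =>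
      hannB _ ((inv_le_one_of_one_le₀ hR.le).trans (hcircle θ).ge) (hcircle θ).le
    have iA : IntervalIntegrable (fun θ => hA (circleMap 0 1 θ, w)) volume 0 (2 * π) :=
      (continuousOn_univ.1 (hsliceA.continuousOn.comp (continuous_circleMap 0 1).continuousOn
        fun θ _ => mA θ)).intervalIntegrable _ _
    have iB : IntervalIntegrable (fun θ => hB (circleMap 0 1 θ, w)) volume 0 (2 * π) :=
      (continuousOn_univ.1 (hsliceB.continuousOn.comp (continuous_circleMap 0 1).continuousOn
        fun θ _ => mB θ)).intervalIntegrable _ _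
    have hpre : ∏ r, ∏ s, poch2 (w.1 r * w.2.1 s) w.2.2.1 w.2.2.2 =
        (∏ r, ∏ s, ∏ c ∈ indexBox (2 * N),
          (1 - w.2.2.1 ^ c.1 * w.2.2.2 ^ c.2 * (w.1 r * w.2.1 s))) * Q w := by
      have : ∀ r s, _ := fun r s => poch2_eq_prod_mul_pochTail hρ hN2 hw.2.2.2.1.le
        hw.2.2.2.2.le (norm_mul_lt_of_mem_boundedRegion hw r s).le
      simp only [this, Finset.prod_mul_distrib, hQ]
    have hpt : ∀ θ, (∏ r, ∏ s, poch2 (w.1 r * w.2.1 s) w.2.2.1 w.2.2.2) *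
        pochIntegrand F (circleMap 0 1 θ, w) =
        Q w * (hA (circleMap 0 1 θ, w) + hB (circleMap 0 1 θ, w)) := by
      intro θ
      set z := circleMap 0 1 θ
      have hz : z ≠ 0 := (mA θ).1
      have n1 : headProd N (z, w) ≠ 0 := headProd_ne_zero N le_rfl (mB θ)
      have n2 : headProdInv N (z, w) ≠ 0 := headProdInv_ne_zero N le_rfl (mA θ)
      have n3 := tailProd_ne_zero N (z, w)
      have hinv : ∏ s, ∏ c ∈ indexBox N, (z - w.2.2.1 ^ c.1 * w.2.2.2 ^ c.2 * w.2.1 s) =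
          (∏ _s : Fin n, ∏ _c ∈ indexBox N, z) * headProdInv N (z, w) := by
        simp only [headProdInv, ← Finset.prod_mul_distrib]
        refine Finset.prod_congr rfl fun s _ => Finset.prod_congr rfl fun c _ => ?_
        field_simp
      have hbez := hab z w.1 w.2.1 w.2.2.1 w.2.2.2
      rw [hinv] at hbez
      rw [hpre, pochIntegrand, denominator_eq (x := (z, w)) hρ hN (hsubA (mA θ)), hbez]
      change (a (z, w) * headProd N (z, w) + b (z, w) * _) * _ * _ = _
      simp only [hAdef, hBdef]
      field_simp
    have hint : (∏ r, ∏ s, poch2 (w.1 r * w.2.1 s) w.2.2.1 w.2.2.2) *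
        ∫ θ in (0 : ℝ)..2 * π, pochIntegrand F (circleMap 0 1 θ, w) =
        Q w * ((∫ θ in (0 : ℝ)..2 * π, hA (circleMap 0 1 θ, w)) +
          ∫ θ in (0 : ℝ)..2 * π, hB (circleMap 0 1 θ, w)) := by
      rw [← intervalIntegral.integral_const_mul, ← intervalIntegral.integral_add iA iB,
        ← intervalIntegral.integral_const_mul]
      exact intervalIntegral.integral_congr fun θ _ => hpt θ
    beta_reduce
    rw [mul_left_comm, mul_left_comm (∏ r, ∏ s, _), hint, eA, ← eB]

theorem exists_mem_boundedRegion {w : (Fin m → ℂ) × (Fin n → ℂ) × ℂ × ℂ} (hw : w ∈ Omega' m n) :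
    ∃ R ρ : ℝ, 1 < R ∧ 0 < ρ ∧ ρ < 1 ∧ w ∈ boundedRegion m n R ρ := by
  obtain ⟨ρ, h1, h2⟩ := exists_between (max_lt hw.2.2.2.1 hw.2.2.2.2.2)
  obtain ⟨hp, hq⟩ := max_lt_iff.1 h1
  refine ⟨‖w.1‖ + ‖w.2.1‖ + 2, ρ, ?_, hw.2.2.1.trans hp, h2, hw, ?_, ?_, hp, hq⟩ <;>
  linarith [norm_nonneg w.1, norm_nonneg w.2.1]

theorem exists_differentiableOn_Omega' {H : (Fin m → ℂ) × (Fin n → ℂ) × ℂ × ℂ → ℂ}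
    (h : ∀ R ρ : ℝ, 1 < R → 0 < ρ → ρ < 1 → ∃ G : (Fin m → ℂ) × (Fin n → ℂ) × ℂ × ℂ → ℂ,
      DifferentiableOn ℂ G (boundedRegion m n R ρ) ∧
      ∀ w ∈ boundedRegion m n R ρ, ‖w.1‖ < 1 → ‖w.2.1‖ < 1 → G w = H w) :
    ∃ G : (Fin m → ℂ) × (Fin n → ℂ) × ℂ × ℂ → ℂ, DifferentiableOn ℂ G (Omega' m n) ∧
      ∀ w ∈ Omega' m n, ‖w.1‖ < 1 → ‖w.2.1‖ < 1 → G w = H w := by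
  choose! G hGd hGeq using h
  choose! Rf ρf hRf h0f hρf hmem using fun w (hw : w ∈ Omega' m n) => exists_mem_boundedRegion hw
  refine ⟨fun w => G (Rf w) (ρf w) w, fun w hw => ?_, fun w hw => ?_⟩
  · have hnhds : boundedRegion m n (Rf w) (ρf w) ∈ 𝓝 w :=
      (isOpen_boundedRegion m n _ _).mem_nhds (hmem w hw)
    have hev : (fun v => G (Rf v) (ρf v) v) =ᶠ[𝓝 w] G (Rf w) (ρf w) := by
      filter_upwards [hnhds] with v hv
      have hagree : EqOn (G (Rf v) (ρf v)) (G (Rf w) (ρf w))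
          (boundedRegion m n (Rf v) (ρf v) ∩ boundedRegion m n (Rf w) (ρf w)) := by
        refine eqOn_of_eqOn_unit_ball
          ((isOpen_boundedRegion m n _ _).inter (isOpen_boundedRegion m n _ _))
          (fun x hx c hc hc1 =>
            ⟨smul_mem_boundedRegion hx.1 hc hc1, smul_mem_boundedRegion hx.2 hc hc1⟩)
          ((hGd _ _ (hRf v hv.1) (h0f v hv.1) (hρf v hv.1)).mono inter_subset_left)
          ((hGd _ _ (hRf w hw) (h0f w hw) (hρf w hw)).mono inter_subset_right) ?_
        intro x hx ht hu
        rw [hGeq _ _ (hRf v hv.1) (h0f v hv.1) (hρf v hv.1) x hx.1 ht hu,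
          hGeq _ _ (hRf w hw) (h0f w hw) (hρf w hw) x hx.2 ht hu]
      exact hagree ⟨hmem v hv.1, hv⟩
    exact (((hGd _ _ (hRf w hw) (h0f w hw) (hρf w hw)).differentiableAt hnhds).congr_of_eventuallyEq
      hev).differentiableWithinAt
  · exact hGeq _ _ (hRf w hw) (h0f w hw) (hρf w hw) w (hmem w hw)

theorem integral_Icc_eq_pochIntegrand (F : ℂ × (Fin m → ℂ) × (Fin n → ℂ) × ℂ × ℂ → ℂ)
    (t : Fin m → ℂ) (u : Fin n → ℂ) (p q : ℂ) :
    ∫ θ in Set.Icc (0 : ℝ) (2 * Real.pi),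
      F (Complex.exp (Complex.I * θ), t, u, p, q) /
        ((∏ r, poch2 (t r * Complex.exp (Complex.I * θ)) p q) *
          ∏ s, poch2 (u s * Complex.exp (-(Complex.I * θ))) p q) =
    ∫ θ in (0 : ℝ)..2 * π, pochIntegrand F (circleMap 0 1 θ, t, u, p, q) := by
  rw [integral_Icc_eq_integral_Ioc, ← intervalIntegral.integral_of_le Real.two_pi_pos.le]
  refine intervalIntegral.integral_congr fun θ _ => ?_
  have : circleMap 0 1 θ = Complex.exp (Complex.I * θ) := by simp [circleMap, mul_comm]
  simp only [pochIntegrand, this, Complex.exp_neg]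

end Continuation

/-- Corollary: holomorphic continuation in the parameters of a contour integral over the
unit circle of a function with `(·;p,q)_∞`-type poles; the continuation is unique since
`Ω'` is connected. -/
theorem meromorphic_continuation (m n : ℕ)
    (F : ℂ × (Fin m → ℂ) × (Fin n → ℂ) × ℂ × ℂ → ℂ)
    (hF : DifferentiableOn ℂ F
      {w : ℂ × (Fin m → ℂ) × (Fin n → ℂ) × ℂ × ℂ |
        w.1 ≠ 0 ∧ (∀ r, w.2.1 r ≠ 0) ∧ (∀ s, w.2.2.1 s ≠ 0) ∧
          0 < ‖w.2.2.2.1‖ ∧ ‖w.2.2.2.1‖ < 1 ∧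
          0 < ‖w.2.2.2.2‖ ∧ ‖w.2.2.2.2‖ < 1}) :
    ∃ G' : (Fin m → ℂ) × (Fin n → ℂ) × ℂ × ℂ → ℂ,
      (DifferentiableOn ℂ G' (Omega' m n) ∧
        ∀ t : Fin m → ℂ, ∀ u : Fin n → ℂ, ∀ p q : ℂ,
          (t, u, p, q) ∈ Omega' m n →
          (∀ r, ‖t r‖ < 1) → (∀ s, ‖u s‖ < 1) →
          G' (t, u, p, q) =
            (∏ r, ∏ s, poch2 (t r * u s) p q) *
              (((1 / (2 * Real.pi) : ℝ) : ℂ) *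
                ∫ θ in Set.Icc (0 : ℝ) (2 * Real.pi),
                  F (Complex.exp (Complex.I * θ), t, u, p, q) /
                    ((∏ r, poch2 (t r * Complex.exp (Complex.I * θ)) p q) *
                      ∏ s, poch2 (u s * Complex.exp (-(Complex.I * θ))) p q))) ∧
      ∀ G'' : (Fin m → ℂ) × (Fin n → ℂ) × ℂ × ℂ → ℂ,
        DifferentiableOn ℂ G'' (Omega' m n) →
        (∀ t : Fin m → ℂ, ∀ u : Fin n → ℂ, ∀ p q : ℂ,
          (t, u, p, q) ∈ Omega' m n →
          (∀ r, ‖t r‖ < 1) → (∀ s, ‖u s‖ < 1) →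
          G'' (t, u, p, q) =
            (∏ r, ∏ s, poch2 (t r * u s) p q) *
              (((1 / (2 * Real.pi) : ℝ) : ℂ) *
                ∫ θ in Set.Icc (0 : ℝ) (2 * Real.pi),
                  F (Complex.exp (Complex.I * θ), t, u, p, q) /
                    ((∏ r, poch2 (t r * Complex.exp (Complex.I * θ)) p q) *
                      ∏ s, poch2 (u s * Complex.exp (-(Complex.I * θ))) p q))) →
        Set.EqOn G'' G' (Omega' m n) := by
  simp only [integral_Icc_eq_pochIntegrand]
  obtain ⟨G, hGd, hG⟩ := exists_differentiableOn_Omega' fun R ρ hR h0 hρ =>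
    exists_differentiableOn_boundedRegion (m := m) (n := n) hF hR h0 hρ
  refine ⟨G, ⟨hGd, fun t u p q hw ht hu => hG _ hw ((pi_norm_lt_iff one_pos).2 ht)
    ((pi_norm_lt_iff one_pos).2 hu)⟩, fun G'' hd hG'' => ?_⟩
  refine eqOn_of_eqOn_unit_ball (isOpen_Omega' m n) (fun w hw c hc _ => smul_mem_Omega' hw hc)
    hd hGd fun w hw ht hu => ?_
  rw [hG w hw ht hu]
  exact hG'' w.1 w.2.1 w.2.2.1 w.2.2.2 hw ((pi_norm_lt_iff one_pos).1 ht)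
    ((pi_norm_lt_iff one_pos).1 hu)
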